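/- arXiv:1802.03747 — 4 statements merged into one kernel-verified Lean document; each statement's English description precedes it below -/
import Mathlib

section
/- Suppose K(r) ≥ k for all r ∈ [0,R], and additionally R ≤ π/√k in case k > 0. Then σ(r) ≤ sin_k(r) for all r ∈ [0,R]. -/
open Real

/-- The generalized sine function `sin_k`: the solution of `y'' + k y = 0`,
`y 0 = 0`, `y' 0 = 1`. -/
noncomputable def sinK (k r : ℝ) : ℝ :=
  if k = 0 then r
  else if 0 < k then Real.sin (Real.sqrt k * r) / Real.sqrt k
  else Real.sinh (Real.sqrt (-k) * r) / Real.sqrt (-k)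
theorem sinK_aux (k : ℝ) : ∃ c : ℝ → ℝ, c 0 = 1 ∧ sinK k 0 = 0 ∧
    (∀ x, HasDerivAt (sinK k) (c x) x) ∧ (∀ x, HasDerivAt c (-k * sinK k x) x) := by
  rcases lt_trichotomy k 0 with h | h | h
  · have hs : 0 < Real.sqrt (-k) := Real.sqrt_pos.2 (by linarith)
    have hq : Real.sqrt (-k) * Real.sqrt (-k) = -k := Real.mul_self_sqrt (by linarith)
    have e : sinK k = fun r => Real.sinh (Real.sqrt (-k) * r) / Real.sqrt (-k) := by
      funext r
      simp [sinK, h.ne, h.not_gt]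
    rw [e]
    have hl : ∀ x : ℝ, HasDerivAt (fun r => Real.sqrt (-k) * r) (Real.sqrt (-k)) x := by
      intro x
      simpa using (hasDerivAt_id x).const_mul (Real.sqrt (-k))
    refine ⟨fun r => Real.cosh (Real.sqrt (-k) * r), by simp, by simp, ?_, ?_⟩
    · intro x
      refine ((hl x).sinh.div_const _).congr_deriv ?_
      field_simp
    · intro x
      refine ((hl x).cosh).congr_deriv ?_
      rw [mul_div_assoc', eq_div_iff hs.ne']
      linear_combination (Real.sinh (Real.sqrt (-k) * x)) * hq
  · have e : sinK k = fun r => r := by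
      funext r
      simp [sinK, h]
    rw [e]
    refine ⟨fun _ => 1, rfl, rfl, fun x => hasDerivAt_id x, fun x => ?_⟩
    simpa [h] using hasDerivAt_const x (1 : ℝ)
  · have hs : 0 < Real.sqrt k := Real.sqrt_pos.2 h
    have hq : Real.sqrt k * Real.sqrt k = k := Real.mul_self_sqrt h.le
    have e : sinK k = fun r => Real.sin (Real.sqrt k * r) / Real.sqrt k := by
      funext r
      simp [sinK, h.ne', h]
    rw [e]
    have hl : ∀ x : ℝ, HasDerivAt (fun r => Real.sqrt k * r) (Real.sqrt k) x := by
      intro x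
      simpa using (hasDerivAt_id x).const_mul (Real.sqrt k)
    refine ⟨fun r => Real.cos (Real.sqrt k * r), by simp, by simp, ?_, ?_⟩
    · intro x
      refine ((hl x).sin.div_const _).congr_deriv ?_
      field_simp
    · intro x
      refine ((hl x).cos).congr_deriv ?_
      have : k * (Real.sin (Real.sqrt k * x) / Real.sqrt k)
          = Real.sqrt k * Real.sin (Real.sqrt k * x) := by
        rw [mul_div_assoc', div_eq_iff hs.ne']
        linear_combination (-Real.sin (Real.sqrt k * x)) * hq
      linarith

theorem sinK_nonneg_aux (k R : ℝ) (hRk : 0 < k → R ≤ π / Real.sqrt k) (x : ℝ) (h0 : 0 ≤ x)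
    (hx : x ≤ R) : 0 ≤ sinK k x := by
  unfold sinK
  split_ifs with h1 h2
  · exact h0
  · have hs : 0 < Real.sqrt k := Real.sqrt_pos.2 h2
    refine div_nonneg (Real.sin_nonneg_of_nonneg_of_le_pi (by positivity) ?_) hs.le
    have := (le_div_iff₀ hs).1 (hx.trans (hRk h2))
    linarith
  · exact div_nonneg (Real.sinh_nonneg_iff.2 (by positivity)) (Real.sqrt_nonneg _)

/-- If `K ≥ k` on `[0,R]` (and `R ≤ π/√k` when `k > 0`), then
`σ(r) ≤ sin_k(r)` for all `r ∈ [0,R]`. -/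
theorem sigma_le_sinK
    (R k : ℝ) (hR : 0 < R) (σ σ' σ'' K : ℝ → ℝ)
    (hderiv : ∀ r ∈ Set.Icc 0 R, HasDerivAt σ (σ' r) r)
    (hderiv' : ∀ r ∈ Set.Icc 0 R, HasDerivAt σ' (σ'' r) r)
    (hcont : ContinuousOn σ'' (Set.Icc 0 R))
    (hσ0 : σ 0 = 0) (hσ'0 : σ' 0 = 1)
    (hσpos : ∀ r ∈ Set.Ioc 0 R, 0 < σ r)
    (hODE : ∀ r ∈ Set.Icc 0 R, σ'' r + K r * σ r = 0)    (hk : ∀ r ∈ Set.Icc 0 R, k ≤ K r)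
    (hRk : 0 < k → R ≤ π / Real.sqrt k) :
    ∀ r ∈ Set.Icc 0 R, σ r ≤ sinK k r := by
  intro r hr
  obtain ⟨c, hc0, hs0, hs, hc⟩ := sinK_aux k
  have hsub : ∀ t ∈ Set.Icc 0 r, t ∈ Set.Icc 0 R := fun t ht => ⟨ht.1, ht.2.trans hr.2⟩
  have hlin : ∀ t : ℝ, HasDerivAt (fun t => r - t) (-1) t := fun t => by
    simpa using (hasDerivAt_id t).const_sub r
  have hg : ∀ t ∈ Set.Icc 0 r, HasDerivAt
      (fun t => σ t * c (r - t) + σ' t * sinK k (r - t))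
      ((k - K t) * (σ t * sinK k (r - t))) t := by
    intro t ht
    have h1 := (hderiv t (hsub t ht)).mul ((hc (r - t)).comp t (hlin t))
    have h2 := (hderiv' t (hsub t ht)).mul ((hs (r - t)).comp t (hlin t))
    refine (h1.add h2).congr_deriv ?_
    simp only [Function.comp]
    linear_combination (sinK k (r - t)) * hODE t (hsub t ht)
  have hanti : AntitoneOn (fun t => σ t * c (r - t) + σ' t * sinK k (r - t)) (Set.Icc 0 r) := by
    refine antitoneOn_of_deriv_nonpos (convex_Icc 0 r)
      (fun t ht => (hg t ht).continuousAt.continuousWithinAt)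
      (fun t ht => (hg t (interior_subset ht)).differentiableAt.differentiableWithinAt) ?_
    intro t ht
    rw [interior_Icc] at ht
    have ht' : t ∈ Set.Icc 0 r := ⟨ht.1.le, ht.2.le⟩
    rw [(hg t ht').deriv]
    have a := hk t (hsub t ht')
    have b := hσpos t ⟨ht.1, ht.2.le.trans hr.2⟩
    have d := sinK_nonneg_aux k R hRk (r - t) (by linarith [ht.2]) (by linarith [ht.1, hr.2])
    exact mul_nonpos_of_nonpos_of_nonneg (by linarith) (mul_nonneg b.le d)
  have := hanti ⟨le_refl 0, hr.1⟩ ⟨hr.1, le_refl r⟩ hr.1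
  simpa [hc0, hs0, hσ0, hσ'0] using this
end

section
/- Suppose K(r) ≥ k for all r ∈ [0,R], and additionally R ≤ π/√k in case k > 0. Then the function r ↦ σ(r)/sin_k(r) is monotonically nonincreasing on (0,R]; that is, for all 0 < r₁ ≤ r₂ ≤ R one has σ(r₁)/sin_k(r₁) ≥ σ(r₂)/sin_k(r₂). -/
open Real

/-- `sinK k` has a derivative `c` solving `c' = -k sinK`. -/
theorem sinK_exists_deriv (k : ℝ) : ∃ c : ℝ → ℝ, (∀ r, HasDerivAt (sinK k) (c r) r) ∧
    (∀ r, HasDerivAt c (-k * sinK k r) r) := by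
  rcases lt_trichotomy k 0 with h | h | h
  · have hq : 0 < Real.sqrt (-k) := Real.sqrt_pos.2 (by linarith)
    have hs : Real.sqrt (-k) * Real.sqrt (-k) = -k := Real.mul_self_sqrt (by linarith)
    have e : sinK k = fun r => Real.sinh (Real.sqrt (-k) * r) / Real.sqrt (-k) := by
      funext r; simp [sinK, h.ne, not_lt.2 h.le]
    refine ⟨fun r => Real.cosh (Real.sqrt (-k) * r), fun r => ?_, fun r => ?_⟩
    · rw [e]
      have := (((hasDerivAt_id r).const_mul (Real.sqrt (-k))).sinh).div_const (Real.sqrt (-k))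
      refine this.congr_deriv ?_
      simp only [id]; field_simp
    · have := ((hasDerivAt_id r).const_mul (Real.sqrt (-k))).cosh
      refine this.congr_deriv ?_
      rw [e]; simp only [id]
      have h2 : -k * (Real.sinh (√(-k) * r) / √(-k)) = √(-k) * Real.sinh (√(-k) * r) := by
        rw [mul_div_assoc', div_eq_iff hq.ne']
        linear_combination (-Real.sinh (√(-k) * r)) * hs
      rw [h2]; ring
  · have e : sinK k = fun r => r := by funext r; simp [sinK, h]
    refine ⟨fun _ => 1, fun r => ?_, fun r => ?_⟩
    · rw [e]; exact hasDerivAt_id r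
    · simpa [h] using hasDerivAt_const r (1 : ℝ)
  · have hq : 0 < Real.sqrt k := Real.sqrt_pos.2 h
    have hs : Real.sqrt k * Real.sqrt k = k := Real.mul_self_sqrt h.le
    have e : sinK k = fun r => Real.sin (Real.sqrt k * r) / Real.sqrt k := by
      funext r; simp [sinK, h.ne', h]
    refine ⟨fun r => Real.cos (Real.sqrt k * r), fun r => ?_, fun r => ?_⟩
    · rw [e]
      have := (((hasDerivAt_id r).const_mul (Real.sqrt k)).sin).div_const (Real.sqrt k)
      refine this.congr_deriv ?_
      simp only [id]; field_simp
    · have := ((hasDerivAt_id r).const_mul (Real.sqrt k)).cos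
      refine this.congr_deriv ?_
      rw [e]; simp only [id]
      have h2 : k * (Real.sin (√k * r) / √k) = √k * Real.sin (√k * r) := by
        rw [mul_div_assoc', div_eq_iff hq.ne']
        linear_combination (-Real.sin (√k * r)) * hs
      linear_combination h2

theorem sinK_zero_right (k : ℝ) : sinK k 0 = 0 := by
  simp [sinK]

theorem sinK_pos_of_lt (k r : ℝ) (hr : 0 < r) (h : 0 < k → r < π / Real.sqrt k) :
    0 < sinK k r := by
  unfold sinK
  split_ifs with h0 h1
  · exact hr
  · have hq : 0 < Real.sqrt k := Real.sqrt_pos.2 h1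
    have := (lt_div_iff₀ hq).1 (h h1)
    exact div_pos (Real.sin_pos_of_pos_of_lt_pi (by positivity) (by linarith)) hq
  · have hk : k < 0 := lt_of_le_of_ne (not_lt.1 h1) h0
    have hq : 0 < Real.sqrt (-k) := Real.sqrt_pos.2 (by linarith)
    exact div_pos (Real.sinh_pos_iff.2 (by positivity)) hq

theorem sinK_end (k : ℝ) (h : 0 < k) : sinK k (π / Real.sqrt k) = 0 := by
  have hq : 0 < Real.sqrt k := Real.sqrt_pos.2 h
  simp [sinK, h.ne', h, mul_div_cancel₀ _ hq.ne']

/-- If `K ≥ k` on `[0,R]` (and `R ≤ π/√k` when `k > 0`), then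
`r ↦ σ(r)/sin_k(r)` is nonincreasing on `(0,R]`. -/
theorem sigma_div_sinK_antitone
    (R k : ℝ) (hR : 0 < R) (σ σ' σ'' K : ℝ → ℝ)
    (hderiv : ∀ r ∈ Set.Icc 0 R, HasDerivAt σ (σ' r) r)
    (hderiv' : ∀ r ∈ Set.Icc 0 R, HasDerivAt σ' (σ'' r) r)
    (hcont : ContinuousOn σ'' (Set.Icc 0 R))
    (hσ0 : σ 0 = 0) (hσ'0 : σ' 0 = 1)
    (hσpos : ∀ r ∈ Set.Ioc 0 R, 0 < σ r)
    (hODE : ∀ r ∈ Set.Icc 0 R, σ'' r + K r * σ r = 0)    (hk : ∀ r ∈ Set.Icc 0 R, k ≤ K r)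
    (hRk : 0 < k → R ≤ π / Real.sqrt k) :
    ∀ r₁ r₂ : ℝ, 0 < r₁ → r₁ ≤ r₂ → r₂ ≤ R →
      σ r₂ / sinK k r₂ ≤ σ r₁ / sinK k r₁ := by
  intro r₁ r₂ h1 h12 h2
  have hlt : ∀ r, 0 < r → r < R → 0 < sinK k r := fun r h0 hr =>
    sinK_pos_of_lt k r h0 (fun hk0 => lt_of_lt_of_le hr (hRk hk0))
  have hnn : ∀ r, 0 < r → r ≤ R → 0 ≤ sinK k r := by
    intro r h0 hr
    by_cases hc : 0 < k → r < π / Real.sqrt k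
    · exact (sinK_pos_of_lt k r h0 hc).le
    · push Not at hc
      obtain ⟨hk0, hc⟩ := hc
      rw [le_antisymm (hr.trans (hRk hk0)) hc, sinK_end k hk0]
  have hr2 : 0 < r₂ := h1.trans_le h12
  rcases (hnn r₂ hr2 h2).eq_or_lt with hz | hp
  · rw [← hz, div_zero]
    exact div_nonneg (hσpos r₁ ⟨h1, h12.trans h2⟩).le (hnn r₁ h1 (h12.trans h2))
  obtain ⟨c, hs, hc⟩ := sinK_exists_deriv k
  have hW : ∀ r ∈ Set.Icc 0 R, HasDerivAt (fun r => σ' r * sinK k r - σ r * c r)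
      (σ'' r * sinK k r + σ' r * c r - (σ' r * c r + σ r * (-k * sinK k r))) r := fun r hr =>
    ((hderiv' r hr).mul (hs r)).sub ((hderiv r hr).mul (hc r))
  have hWanti : AntitoneOn (fun r => σ' r * sinK k r - σ r * c r) (Set.Icc 0 R) := by
    refine antitoneOn_of_hasDerivWithinAt_nonpos (convex_Icc 0 R)
      (fun r hr => (hW r hr).continuousAt.continuousWithinAt)
      (fun r hr => (hW r (interior_subset hr)).hasDerivWithinAt) ?_
    intro r hr
    rw [interior_Icc] at hr
    have hr' := Set.Ioo_subset_Icc_self hr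
    have e1 : σ'' r = -(K r * σ r) := by linarith [hODE r hr']
    have e2 := mul_nonneg (sub_nonneg.2 (hk r hr'))
      (mul_pos (hσpos r ⟨hr.1, hr.2.le⟩) (hlt r hr.1 hr.2)).le
    rw [e1]
    nlinarith
  have hWle : ∀ r ∈ Set.Icc 0 R, σ' r * sinK k r - σ r * c r ≤ 0 := by
    intro r hr
    have := hWanti (Set.left_mem_Icc.2 hR.le) hr hr.1
    simpa [hσ0, sinK_zero_right] using this
  have hpos : ∀ r ∈ Set.Icc r₁ r₂, 0 < sinK k r := by
    intro r hr
    rcases hr.2.eq_or_lt with h | h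
    · rw [h]; exact hp
    · exact hlt r (h1.trans_le hr.1) (h.trans_le h2)
  have hD : ∀ r ∈ Set.Icc r₁ r₂, HasDerivAt (fun r => σ r / sinK k r)
      ((σ' r * sinK k r - σ r * c r) / sinK k r ^ 2) r := fun r hr =>
    (hderiv r ⟨h1.le.trans hr.1, hr.2.trans h2⟩).div (hs r) (hpos r hr).ne'
  have hfin : AntitoneOn (fun r => σ r / sinK k r) (Set.Icc r₁ r₂) := by
    refine antitoneOn_of_hasDerivWithinAt_nonpos (convex_Icc r₁ r₂)
      (fun r hr => (hD r hr).continuousAt.continuousWithinAt)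
      (fun r hr => (hD r (interior_subset hr)).hasDerivWithinAt) ?_
    intro r hr
    have hr' := interior_subset hr
    exact div_nonpos_of_nonpos_of_nonneg (hWle r ⟨h1.le.trans hr'.1, hr'.2.trans h2⟩) (sq_nonneg _)
  exact hfin (Set.left_mem_Icc.2 h12) (Set.right_mem_Icc.2 h12) h12
end

section
/- Let k > 0 and suppose K(r) ≥ k for all r ∈ [0,R], with R ≤ π/√k. Then the function h(r) := σ'(r)·sin(√k·r) − √k·σ(r)·cos(√k·r) is monotonically nonincreasing on [0,R], and h(r) ≤ 0 for all r ∈ [0,R]. -/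
open Real

/-- For `k > 0` with `K ≥ k` on `[0,R]` and `R ≤ π/√k`, the function
`h(r) = σ'(r)·sin(√k·r) − √k·σ(r)·cos(√k·r)` is nonincreasing on `[0,R]`
and nonpositive there. -/
theorem wronskian_antitone_nonpos_pos_curv
    (R k : ℝ) (hR : 0 < R) (σ σ' σ'' K : ℝ → ℝ)
    (hderiv : ∀ r ∈ Set.Icc 0 R, HasDerivAt σ (σ' r) r)
    (hderiv' : ∀ r ∈ Set.Icc 0 R, HasDerivAt σ' (σ'' r) r)
    (hcont : ContinuousOn σ'' (Set.Icc 0 R))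
    (hσ0 : σ 0 = 0) (hσ'0 : σ' 0 = 1)
    (hσpos : ∀ r ∈ Set.Ioc 0 R, 0 < σ r)
    (hODE : ∀ r ∈ Set.Icc 0 R, σ'' r + K r * σ r = 0)    (hkpos : 0 < k)
    (hk : ∀ r ∈ Set.Icc 0 R, k ≤ K r)
    (hRk : R ≤ π / Real.sqrt k) :
    AntitoneOn (fun r => σ' r * Real.sin (Real.sqrt k * r)
        - Real.sqrt k * σ r * Real.cos (Real.sqrt k * r)) (Set.Icc 0 R) ∧
    ∀ r ∈ Set.Icc 0 R,
      σ' r * Real.sin (Real.sqrt k * r)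
        - Real.sqrt k * σ r * Real.cos (Real.sqrt k * r) ≤ 0 := by
  have hs : 0 < Real.sqrt k := Real.sqrt_pos.mpr hkpos
  have hss : Real.sqrt k * Real.sqrt k = k := Real.mul_self_sqrt hkpos.le
  have hd : ∀ r ∈ Set.Icc 0 R, HasDerivAt (fun r => σ' r * Real.sin (Real.sqrt k * r)
      - Real.sqrt k * σ r * Real.cos (Real.sqrt k * r))
      ((k - K r) * σ r * Real.sin (Real.sqrt k * r)) r := by
    intro r hr
    have hl : HasDerivAt (fun r : ℝ => Real.sqrt k * r) (Real.sqrt k) r := by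
      simpa using (hasDerivAt_id r).const_mul (Real.sqrt k)
    have h1 := (hderiv' r hr).mul hl.sin
    have h2 := ((hderiv r hr).const_mul (Real.sqrt k)).mul hl.cos
    have h3 := h1.sub h2
    refine h3.congr_deriv ?_
    have := hODE r hr
    linear_combination (Real.sin (Real.sqrt k * r)) * this
      + σ r * Real.sin (Real.sqrt k * r) * hss
  have hanti : AntitoneOn (fun r => σ' r * Real.sin (Real.sqrt k * r)
        - Real.sqrt k * σ r * Real.cos (Real.sqrt k * r)) (Set.Icc 0 R) := by
    refine antitoneOn_of_deriv_nonpos (convex_Icc 0 R)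
      (fun r hr => (hd r hr).continuousAt.continuousWithinAt)
      (fun r hr => (hd r (interior_subset hr)).differentiableAt.differentiableWithinAt) ?_
    intro r hr
    rw [(hd r (interior_subset hr)).deriv]
    rw [interior_Icc] at hr
    have hr' : r ∈ Set.Icc 0 R := ⟨hr.1.le, hr.2.le⟩
    have hsin : 0 ≤ Real.sin (Real.sqrt k * r) := by
      apply Real.sin_nonneg_of_nonneg_of_le_pi
      · exact mul_nonneg hs.le hr'.1
      · have := (le_div_iff₀ hs).mp (hr'.2.trans hRk)
        linarith
    have hσ := hσpos r ⟨hr.1, hr.2.le⟩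
    exact mul_nonpos_of_nonpos_of_nonneg
      (mul_nonpos_of_nonpos_of_nonneg (sub_nonpos.mpr (hk r hr')) hσ.le) hsin
  refine ⟨hanti, fun r hr => ?_⟩
  have := hanti (Set.left_mem_Icc.mpr hR.le) hr hr.1
  simpa [hσ0] using this
end

section
/- Suppose K(r) ≤ k for all r ∈ [0,R], and additionally R ≤ π/√k and sin_k(r) > 0 for r ∈ (0,R] in case k > 0. Then σ(r) ≥ sin_k(r) for all r ∈ [0,R]. -/
open Real

/-- Existence of the derivative `c` of `sinK k`, with its own derivative, and initial values. -/
lemma sinK_facts (k : ℝ) : ∃ c : ℝ → ℝ, (∀ r, HasDerivAt (sinK k) (c r) r) ∧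
    (∀ r, HasDerivAt c (-k * sinK k r) r) ∧ c 0 = 1 ∧ sinK k 0 = 0 := by
  rcases lt_trichotomy k 0 with h | h | h
  · have hs : 0 < Real.sqrt (-k) := Real.sqrt_pos.mpr (by linarith)
    have hq : Real.sqrt (-k) * Real.sqrt (-k) = -k := Real.mul_self_sqrt (by linarith)
    have e : sinK k = fun r => Real.sinh (Real.sqrt (-k) * r) / Real.sqrt (-k) := by
      funext r; simp [sinK, h.ne, not_lt.mpr h.le]
    rw [e]
    refine ⟨fun r => Real.cosh (Real.sqrt (-k) * r), fun r => ?_, fun r => ?_, by simp, by simp⟩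
    · have := (((hasDerivAt_id r).const_mul (Real.sqrt (-k))).sinh).div_const (Real.sqrt (-k))
      refine this.congr_deriv ?_
      simp only [id]; field_simp
    · have := ((hasDerivAt_id r).const_mul (Real.sqrt (-k))).cosh
      refine this.congr_deriv ?_
      simp only [id]
      generalize Real.sqrt (-k) = q at *
      rw [← hq]; field_simp
  · subst h
    have e : sinK 0 = fun r => r := by funext r; simp [sinK]
    rw [e]
    exact ⟨fun _ => 1, fun r => hasDerivAt_id r,
      fun r => (hasDerivAt_const r (1 : ℝ)).congr_deriv (by simp), rfl, rfl⟩
  · have hs : 0 < Real.sqrt k := Real.sqrt_pos.mpr h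
    have hq : Real.sqrt k * Real.sqrt k = k := Real.mul_self_sqrt h.le
    have e : sinK k = fun r => Real.sin (Real.sqrt k * r) / Real.sqrt k := by
      funext r; simp [sinK, h.ne', h]
    rw [e]
    refine ⟨fun r => Real.cos (Real.sqrt k * r), fun r => ?_, fun r => ?_, by simp, by simp⟩
    · have := (((hasDerivAt_id r).const_mul (Real.sqrt k)).sin).div_const (Real.sqrt k)
      refine this.congr_deriv ?_
      simp only [id]; field_simp
    · have := ((hasDerivAt_id r).const_mul (Real.sqrt k)).cos
      refine this.congr_deriv ?_
      simp only [id]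
      have : -k = -(Real.sqrt k * Real.sqrt k) := by rw [hq]
      rw [this]; field_simp

/-- If `K ≤ k` on `[0,R]` (and `R ≤ π/√k`, `sin_k > 0` on `(0,R]` when
`k > 0`), then `σ(r) ≥ sin_k(r)` for all `r ∈ [0,R]`. -/
theorem sinK_le_sigma
    (R k : ℝ) (hR : 0 < R) (σ σ' σ'' K : ℝ → ℝ)
    (hderiv : ∀ r ∈ Set.Icc 0 R, HasDerivAt σ (σ' r) r)
    (hderiv' : ∀ r ∈ Set.Icc 0 R, HasDerivAt σ' (σ'' r) r)
    (hcont : ContinuousOn σ'' (Set.Icc 0 R))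
    (hσ0 : σ 0 = 0) (hσ'0 : σ' 0 = 1)
    (hσpos : ∀ r ∈ Set.Ioc 0 R, 0 < σ r)
    (hODE : ∀ r ∈ Set.Icc 0 R, σ'' r + K r * σ r = 0)    (hk : ∀ r ∈ Set.Icc 0 R, K r ≤ k)
    (hRk : 0 < k → R ≤ π / Real.sqrt k)
    (hsinKpos : 0 < k → ∀ r ∈ Set.Ioc 0 R, 0 < sinK k r) :
    ∀ r ∈ Set.Icc 0 R, sinK k r ≤ σ r := by
  intro r hr
  obtain ⟨c, hs, hc, hc0, hs0⟩ := sinK_facts k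
  have hpos : ∀ t ∈ Set.Ioc 0 R, 0 ≤ sinK k t := by
    intro t ht
    rcases lt_trichotomy k 0 with h | h | h
    · simp only [sinK, h.ne, not_lt.mpr h.le, if_false]
      exact div_nonneg (Real.sinh_nonneg_iff.mpr (mul_nonneg (Real.sqrt_nonneg _) ht.1.le))
        (Real.sqrt_nonneg _)
    · simpa [sinK, h] using ht.1.le
    · exact (hsinKpos h t ht).le
  -- variation of constants
  have hf : ∀ t ∈ Set.Icc 0 r, HasDerivAt
      (fun t => σ t * c (r - t) + σ' t * sinK k (r - t))
      ((k - K t) * σ t * sinK k (r - t)) t := by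
    intro t ht
    have htR : t ∈ Set.Icc 0 R := ⟨ht.1, ht.2.trans hr.2⟩
    have h1 : HasDerivAt (fun t => r - t) (-1) t := (hasDerivAt_id t).const_sub r
    have h2 := (hc (r - t)).comp t h1
    have h3 := (hs (r - t)).comp t h1
    refine (((hderiv t htR).mul h2).add ((hderiv' t htR).mul h3)).congr_deriv ?_
    have := hODE t htR
    simp only [Function.comp]
    linear_combination sinK k (r - t) * this
  have hmono : MonotoneOn (fun t => σ t * c (r - t) + σ' t * sinK k (r - t)) (Set.Icc 0 r) := by
    apply monotoneOn_of_deriv_nonneg (convex_Icc 0 r)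
    · exact fun t ht => (hf t ht).continuousAt.continuousWithinAt
    · intro t ht
      exact (hf t (interior_subset ht)).differentiableAt.differentiableWithinAt
    · intro t ht
      rw [(hf t (interior_subset ht)).deriv]
      rw [interior_Icc] at ht
      have htR : t ≤ R := ht.2.le.trans hr.2
      have h1 := hk t ⟨ht.1.le, htR⟩
      have h2 := hσpos t ⟨ht.1, htR⟩
      have h3 := hpos (r - t) ⟨by linarith [ht.2], by linarith [ht.1, hr.2]⟩
      exact mul_nonneg (mul_nonneg (by linarith) h2.le) h3
  have := hmono (Set.left_mem_Icc.mpr hr.1) (Set.right_mem_Icc.mpr hr.1) hr.1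
  simpa [hσ0, hσ'0, hc0, hs0] using this
end
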